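/- arXiv:2008.03463 — 2 statements merged into one kernel-verified Lean document; each statement's English description precedes it below -/
import Mathlib

section
/- Let Σ_A be a one-sided countable topological Markov shift, φ : Σ_A → ℝ a measurable potential, λ > 0, and ν a (φ,λ)-conformal σ-finite Borel measure with ν([a]) < ∞ for every a ∈ ℕ. If sup_{x∈Σ_A} L_φ 1(x) < ∞ (where 1 denotes the constant function 1), then ν(π_n^{−1}{a}) < ∞ for every n ≥ 1 and every a ∈ ℕ, where π_n(x) := x_n. In particular, for every n ≥ 1 the sub-σ-algebra σ^{−n}𝓑 is compatible with ν. -/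
open MeasureTheory Filter Topology ENNReal

namespace CMS

/-- A sequence is admissible for the transition matrix `A`. -/
def IsAdm (A : ℕ → ℕ → Bool) (u : ℕ → ℕ) : Prop := ∀ i, A (u i) (u (i + 1)) = true

/-- The one-sided countable topological Markov shift. -/
abbrev Space (A : ℕ → ℕ → Bool) := {u : ℕ → ℕ // IsAdm A u}

/-- The transition matrix has no row and no column identically zero. -/
def NoDegenerate (A : ℕ → ℕ → Bool) : Prop :=
  (∀ i, ∃ j, A i j = true) ∧ (∀ j, ∃ i, A i j = true)

/-- The shift map. -/
def shift {A : ℕ → ℕ → Bool} (x : Space A) : Space A :=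
  ⟨fun i => x.1 (i + 1), fun i => x.2 (i + 1)⟩

/-- Birkhoff (ergodic) sum `φ_n`. -/
noncomputable def birkhoff {A : ℕ → ℕ → Bool} (φ : Space A → ℝ) (n : ℕ) (x : Space A) : ℝ :=
  ∑ i ∈ Finset.range n, φ (shift^[i] x)

/-- The cylinder set determined by a word. -/
def cyl (A : ℕ → ℕ → Bool) (w : List ℕ) : Set (Space A) :=
  {x | ∀ i : Fin w.length, x.1 i = w.get i}

/-- Concatenation of a finite word with a sequence. -/
def concatSeq (w : List ℕ) (u : ℕ → ℕ) : ℕ → ℕ :=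
  fun i => if h : i < w.length then w.get ⟨i, h⟩ else u (i - w.length)

/-- Prepending a single symbol to a sequence. -/
def prependSeq (a : ℕ) (u : ℕ → ℕ) : ℕ → ℕ := fun i => Nat.casesOn i a u

/-- The set of points to which the symbol `a` may be prepended. -/
def admits (A : ℕ → ℕ → Bool) (a : ℕ) : Set (Space A) := {x | A a (x.1 0) = true}

/-- Prepending a symbol to a point of the shift space (identity if not admissible). -/
noncomputable def prep (A : ℕ → ℕ → Bool) (a : ℕ) (x : Space A) : Space A :=
  if h : A a (x.1 0) = true then
    ⟨prependSeq a x.1, by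
      intro i
      cases i with
      | zero => exact h
      | succ j => exact x.2 j⟩
  else x

/-- The measure `ν ⊚ σ`, `ν⊚σ(E) = Σ_a ν(σ(E ∩ [a]))`. -/
noncomputable def circ (A : ℕ → ℕ → Bool) (ν : Measure (Space A)) : Measure (Space A) :=
  Measure.sum fun a : ℕ => (ν.restrict (admits A a)).map (prep A a)

/-- `ν` is `(φ, l)`-conformal: `dν/d(ν⊚σ) = l⁻¹ e^φ`. -/
def Conformal (A : ℕ → ℕ → Bool) (φ : Space A → ℝ) (l : ℝ) (ν : Measure (Space A)) : Prop :=
  ∀ E : Set (Space A), MeasurableSet E →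
    ν E = ∫⁻ x in E, ENNReal.ofReal (l⁻¹ * Real.exp (φ x)) ∂(circ A ν)

/-- The Ruelle transfer operator. -/
noncomputable def ruelle (A : ℕ → ℕ → Bool) (φ f : Space A → ℝ) (x : Space A) : ℝ :=
  ∑' a : ℕ, if A a (x.1 0) = true then Real.exp (φ (prep A a x)) * f (prep A a x) else 0

/-- The Ruelle operator applied to the constant function 1, valued in `ℝ≥0∞`. -/
noncomputable def ruelleOne (A : ℕ → ℕ → Bool) (φ : Space A → ℝ) (x : Space A) : ℝ≥0∞ :=
  ∑' a : ℕ, if A a (x.1 0) = true then ENNReal.ofReal (Real.exp (φ (prep A a x))) else 0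

/-- `L*_φ ν = l ν` : the dual eigenmeasure equation. -/
def DualEigen (A : ℕ → ℕ → Bool) (φ : Space A → ℝ) (l : ℝ) (ν : Measure (Space A)) : Prop :=
  ∀ f : Space A → ℝ, Integrable f ν →
    ∫ x, ruelle A φ f x ∂ν = l * ∫ x, f x ∂ν

/-- The sub-σ-algebra `σ^{-n} 𝓑`. -/
def shiftSigma (A : ℕ → ℕ → Bool) (n : ℕ) : MeasurableSpace (Space A) :=
  MeasurableSpace.comap (shift^[n]) inferInstance

/-- A sub-σ-algebra `m` is compatible with `ν`: the restriction of `ν` to `m` is σ-finite. -/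
def Compatible (A : ℕ → ℕ → Bool) (ν : Measure (Space A))
    (m : MeasurableSpace (Space A)) : Prop :=
  ∃ s : ℕ → Set (Space A), (∀ k, MeasurableSet[m] (s k)) ∧ (∀ k, ν (s k) ≠ ⊤) ∧
    (⋃ k, s k) = Set.univ

open Classical in
/-- Numerator of the DLR kernel: `e^{φ_n(w σ^n x)} 1{w σ^n x ∈ Σ_A}`. -/
noncomputable def dlrNum (A : ℕ → ℕ → Bool) (φ : Space A → ℝ) (w : List ℕ)
    (x : Space A) : ℝ :=
  if h : IsAdm A (concatSeq w ((shift^[w.length] x).1)) then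
    Real.exp (birkhoff φ w.length (⟨concatSeq w ((shift^[w.length] x).1), h⟩ : Space A))
  else 0

/-- Denominator of the DLR kernel: `Σ_{y : σ^n y = σ^n x} e^{φ_n(y)}`. -/
noncomputable def dlrDen (A : ℕ → ℕ → Bool) (φ : Space A → ℝ) (n : ℕ) (x : Space A) : ℝ :=
  ∑' y : {y : Space A // shift^[n] y = shift^[n] x}, Real.exp (birkhoff φ n y.1)

/-- `ν` is a `φ`-DLR measure. -/
def IsDLR (A : ℕ → ℕ → Bool) (φ : Space A → ℝ) (ν : Measure (Space A)) : Prop :=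
  ∀ n : ℕ, 1 ≤ n →
    Compatible A ν (shiftSigma A n) ∧
    ∀ w : List ℕ, w.length = n →
      (ν[Set.indicator (cyl A w) (fun _ => (1 : ℝ))|shiftSigma A n])
        =ᵐ[ν] fun x => dlrNum A φ w x / dlrDen A φ n x

/-- `ν` is non-singular: `ν ∘ σ⁻¹ ∼ ν`. -/
def NonSingular (A : ℕ → ℕ → Bool) (ν : Measure (Space A)) : Prop :=
  ν.map shift ≪ ν ∧ ν ≪ ν.map shift

/-- Conservative non-singular measure. -/
def Conservative (A : ℕ → ℕ → Bool) (ν : Measure (Space A)) : Prop :=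
  NonSingular A ν ∧
    ∀ W : Set (Space A), MeasurableSet W →
      (∀ i j : ℕ, i ≠ j → ν ((shift^[i] ⁻¹' W) ∩ (shift^[j] ⁻¹' W)) = 0) → ν W = 0

/-- The `n`-th variation `Var_n φ`, valued in `ℝ≥0∞`. -/
noncomputable def varn (A : ℕ → ℕ → Bool) (φ : Space A → ℝ) (n : ℕ) : ℝ≥0∞ :=
  ⨆ (x : Space A) (y : Space A) (_ : ∀ i, i < n → x.1 i = y.1 i),
    ENNReal.ofReal |φ x - φ y|

noncomputable def waltersBound (A : ℕ → ℕ → Bool) (φ : Space A → ℝ) (k : ℕ) : ℝ≥0∞ :=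
  ⨆ (n : ℕ) (_ : 1 ≤ n), varn A (birkhoff φ n) (n + k)

/-- The Walters condition. -/
def Walters (A : ℕ → ℕ → Bool) (φ : Space A → ℝ) : Prop :=
  (∀ k, 1 ≤ k → waltersBound A φ k ≠ ⊤) ∧
  Tendsto (waltersBound A φ) atTop (nhds 0)

/-- `φ` is weakly Hölder continuous. -/
def WeaklyHolder (A : ℕ → ℕ → Bool) (φ : Space A → ℝ) : Prop :=
  ∃ H θ : ℝ, 0 < H ∧ θ ∈ Set.Ioo (0 : ℝ) 1 ∧
    ∀ n : ℕ, 2 ≤ n → varn A φ n ≤ ENNReal.ofReal (H * θ ^ n)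

/-- The partition function `Z_n(φ, a)`, valued in `ℝ≥0∞`. -/
noncomputable def Zn (A : ℕ → ℕ → Bool) (φ : Space A → ℝ) (n a : ℕ) : ℝ≥0∞ :=
  ∑' x : {x : Space A // shift^[n] x = x ∧ x.1 0 = a},
    ENNReal.ofReal (Real.exp (birkhoff φ n x.1))

/-- The partition function `Z*_n(φ, a)` over periodic points whose first return to `[a]` is `n`. -/
noncomputable def Znstar (A : ℕ → ℕ → Bool) (φ : Space A → ℝ) (n a : ℕ) : ℝ≥0∞ :=
  ∑' x : {x : Space A // shift^[n] x = x ∧ x.1 0 = a ∧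
      ∀ k, 0 < k → k < n → (shift^[k] x).1 0 ≠ a},
    ENNReal.ofReal (Real.exp (birkhoff φ n x.1))

/-- `P` is the (finite) Gurevich pressure of `φ`. -/
def HasGurevich (A : ℕ → ℕ → Bool) (φ : Space A → ℝ) (P : ℝ) : Prop :=
  ∀ a : ℕ, (cyl A [a]).Nonempty →
    (∀ n, 1 ≤ n → Zn A φ n a ≠ ⊤) ∧
    Tendsto (fun n : ℕ => Real.log (Zn A φ n a).toReal / n) atTop (nhds P)

/-- `φ` is recurrent (with Gurevich pressure `P`). -/
def Recurrent (A : ℕ → ℕ → Bool) (φ : Space A → ℝ) (P : ℝ) : Prop :=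
  ∀ a : ℕ, (cyl A [a]).Nonempty →
    ∑' n : ℕ, ENNReal.ofReal (Real.exp (-((n + 1 : ℕ) : ℝ) * P)) * Zn A φ (n + 1) a = ⊤

/-- `φ` is positive recurrent (with Gurevich pressure `P`). -/
def PosRecurrent (A : ℕ → ℕ → Bool) (φ : Space A → ℝ) (P : ℝ) : Prop :=
  Recurrent A φ P ∧
  ∀ a : ℕ, (cyl A [a]).Nonempty →
    ∑' n : ℕ, ((n + 1 : ℕ) : ℝ≥0∞) *
      ENNReal.ofReal (Real.exp (-((n + 1 : ℕ) : ℝ) * P)) * Znstar A φ (n + 1) a ≠ ⊤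

/-- `φ` is transient (with Gurevich pressure `P`). -/
def Transient (A : ℕ → ℕ → Bool) (φ : Space A → ℝ) (P : ℝ) : Prop :=
  ∀ a : ℕ, (cyl A [a]).Nonempty →
    ∑' n : ℕ, ENNReal.ofReal (Real.exp (-((n + 1 : ℕ) : ℝ) * P)) * Zn A φ (n + 1) a ≠ ⊤

/-- `Σ_A` is topologically mixing. -/
def TopMixing (A : ℕ → ℕ → Bool) : Prop :=
  ∀ a b : ℕ, ∃ N : ℕ, ∀ n, N < n → ∃ x : Space A, x.1 0 = a ∧ (shift^[n] x).1 0 = b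

/-- The big images and preimages (BIP) property. -/
def BIP (A : ℕ → ℕ → Bool) : Prop :=
  ∃ (N : ℕ) (b : Fin N → ℕ), ∀ a : ℕ,
    (∃ i, A (b i) a = true) ∧ (∃ j, A a (b j) = true)

/-- An admissible word. -/
def AdmWord (A : ℕ → ℕ → Bool) (w : List ℕ) : Prop :=
  ∀ (i : ℕ) (h : i + 1 < w.length),
    A (w.get ⟨i, Nat.lt_of_succ_lt h⟩) (w.get ⟨i + 1, h⟩) = true

/-- The image of `E ⊆ [a̲]` under the cylinder-swapping map `v_{a̲,b̲}`. -/
def swapImage (A : ℕ → ℕ → Bool) (b : List ℕ) (E : Set (Space A)) : Set (Space A) :=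
  {y | ∃ x ∈ E, y.1 = concatSeq b ((shift^[b.length] x).1)}

/-- The image of `E` under the prepending map `I_b`. -/
def prepImage (A : ℕ → ℕ → Bool) (b : ℕ) (E : Set (Space A)) : Set (Space A) :=
  {y | ∃ x ∈ E, y.1 = prependSeq b x.1}

/-- The transition matrix of the renewal shift:
`A(1,1) = A(1,i) = A(i,i-1) = 1` (for `i > 1`), all other entries `0`. -/
def renA : ℕ → ℕ → Bool := fun i j => decide ((i = 1 ∧ 1 ≤ j) ∨ (2 ≤ i ∧ j = i - 1))

/-- The transition matrix of the shift `Σ_{𝓡⁻}`: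
`A(i,i+1) = A(i,1) = 1` for `i ≥ 1`, all other entries `0`. -/
def rminusA : ℕ → ℕ → Bool := fun i j => decide (1 ≤ i ∧ (j = i + 1 ∨ j = 1))

/-- The periodic sequence obtained by repeating the word `w`. -/
def perSeq (w : List ℕ) : ℕ → ℕ := fun i => w.getD (i % w.length) 0

/-- The word `(j, j-1, …, 1, n, n-1, …, j+1)`. -/
def gammaWord (j n : ℕ) : List ℕ :=
  ((List.range j).map (· + 1)).reverse ++ ((List.range (n - j)).map (· + (j + 1))).reverse

/-- The point `x̄ = (1, 2, 3, …)` of `Σ_{𝓡⁻}`. -/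
def xbar : Space rminusA := ⟨fun i => i + 1, by intro i; simp [rminusA]⟩

theorem measurable_apply_coord {A : ℕ → ℕ → Bool} (i : ℕ) :
    Measurable fun x : Space A => x.1 i :=
  (measurable_pi_apply i).comp measurable_subtype_coe

theorem measurableSet_coord_eq {A : ℕ → ℕ → Bool} (n a : ℕ) :
    MeasurableSet {x : Space A | x.1 n = a} :=
  measurable_apply_coord n (measurableSet_singleton a)

theorem measurableSet_admits (A : ℕ → ℕ → Bool) (a : ℕ) : MeasurableSet (admits A a) :=
  measurable_apply_coord 0 (MeasurableSet.of_discrete (s := {j | A a j = true}))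

theorem measurable_shift {A : ℕ → ℕ → Bool} : Measurable (shift (A := A)) :=
  (measurable_pi_iff.2 fun i => measurable_apply_coord (i + 1)).subtype_mk

theorem prep_apply_of_mem {A : ℕ → ℕ → Bool} {a : ℕ} {x : Space A} (h : x ∈ admits A a) (i : ℕ) :
    (prep A a x).1 i = prependSeq a x.1 i := by
  have h' : A a (x.1 0) = true := h
  simp [prep, h']

theorem shift_prep {A : ℕ → ℕ → Bool} {a : ℕ} {x : Space A} (h : x ∈ admits A a) :
    shift (prep A a x) = x := by
  ext i
  exact prep_apply_of_mem h (i + 1)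

theorem measurable_prep (A : ℕ → ℕ → Bool) (a : ℕ) : Measurable (prep A a) := by
  have hcoe : Measurable fun x => (prep A a x).1 := by
    refine measurable_pi_iff.2 fun i => ?_
    have hi : Measurable fun x : Space A => prependSeq a x.1 i := by
      cases i with
      | zero => exact measurable_const
      | succ j => exact measurable_apply_coord j
    classical
    have heq : (fun x => (prep A a x).1 i) =
        fun x => if x ∈ admits A a then prependSeq a x.1 i else x.1 i := by
      funext x
      by_cases hx : x ∈ admits A a
      · rw [if_pos hx, prep_apply_of_mem hx]
      · have hx' : ¬ A a (x.1 0) = true := hx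
        simp [hx, prep, hx']
    rw [heq]
    exact Measurable.ite (measurableSet_admits A a) hi (measurable_apply_coord i)
  exact hcoe.subtype_mk

/-- Transfer operator identity: `ν (σ⁻¹ B) = l⁻¹ ∫_B L_φ 1 dν`. -/
theorem Conformal.measure_preimage_shift {A : ℕ → ℕ → Bool} {φ : Space A → ℝ}
    (hφ : Measurable φ) {l : ℝ} (hl : 0 < l) {ν : Measure (Space A)}
    (hconf : Conformal A φ l ν) {B : Set (Space A)} (hB : MeasurableSet B) :
    ν (shift ⁻¹' B) = ENNReal.ofReal l⁻¹ * ∫⁻ x in B, ruelleOne A φ x ∂ν := by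
  have hg : Measurable fun x => ENNReal.ofReal (l⁻¹ * Real.exp (φ x)) := by fun_prop
  have hexp : Measurable fun x => ENNReal.ofReal (Real.exp (φ x)) := by fun_prop
  have hterm (a : ℕ) : Measurable fun x : Space A =>
      if A a (x.1 0) = true then ENNReal.ofReal (Real.exp (φ (prep A a x))) else 0 :=
    Measurable.ite (measurableSet_admits A a) (hexp.comp (measurable_prep A a)) measurable_const
  have hS := measurable_shift hB
  rw [hconf _ hS, circ, ← lintegral_indicator hS, lintegral_sum_measure]
  simp only [ruelleOne]
  rw [lintegral_tsum fun a => (hterm a).aemeasurable, ← ENNReal.tsum_mul_left]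
  refine tsum_congr fun a => ?_
  rw [lintegral_map (hg.indicator hS) (measurable_prep A a),
    ← lintegral_const_mul _ (hterm a), ← lintegral_indicator hB,
    ← lintegral_indicator (measurableSet_admits A a)]
  refine lintegral_congr fun x => ?_
  by_cases hx : x ∈ admits A a
  · have hx' : A a (x.1 0) = true := hx
    by_cases hxB : x ∈ B <;>
      simp [Set.indicator, hx, hx', hxB, shift_prep hx, ENNReal.ofReal_mul (inv_nonneg.2 hl.le)]
  · have hx' : ¬ A a (x.1 0) = true := hx
    simp [Set.indicator, hx, hx']

theorem Conformal.measure_preimage_shift_ne_top {A : ℕ → ℕ → Bool} {φ : Space A → ℝ}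
    (hφ : Measurable φ) {l : ℝ} (hl : 0 < l) {ν : Measure (Space A)}
    (hconf : Conformal A φ l ν) (hbdd : (⨆ x : Space A, ruelleOne A φ x) ≠ ⊤)
    {B : Set (Space A)} (hB : MeasurableSet B) (hfin : ν B ≠ ⊤) :
    ν (shift ⁻¹' B) ≠ ⊤ := by
  rw [hconf.measure_preimage_shift hφ hl hB]
  refine ENNReal.mul_ne_top ENNReal.ofReal_ne_top (ne_top_of_le_ne_top
    (ENNReal.mul_ne_top hbdd hfin) ?_)
  calc ∫⁻ x in B, ruelleOne A φ x ∂ν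
      ≤ ∫⁻ _ in B, (⨆ x : Space A, ruelleOne A φ x) ∂ν :=
        lintegral_mono fun x => le_iSup (ruelleOne A φ) x
    _ = (⨆ x : Space A, ruelleOne A φ x) * ν B := setLIntegral_const _ _

theorem iterate_shift_apply {A : ℕ → ℕ → Bool} (n : ℕ) (x : Space A) (i : ℕ) :
    (shift^[n] x).1 i = x.1 (i + n) := by
  induction n generalizing x with
  | zero => rfl
  | succ n ih => rw [Function.iterate_succ_apply, ih]; rfl

theorem statement1 (A : ℕ → ℕ → Bool) (hA : NoDegenerate A)
    (φ : Space A → ℝ) (hφ : Measurable φ) (l : ℝ) (hl : 0 < l)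
    (ν : Measure (Space A)) (hsf : SigmaFinite ν)
    (hconf : Conformal A φ l ν)
    (hfin : ∀ a : ℕ, ν (cyl A [a]) ≠ ⊤)
    (hbdd : (⨆ x : Space A, ruelleOne A φ x) ≠ ⊤) :
    (∀ n : ℕ, 1 ≤ n → ∀ a : ℕ, ν {x : Space A | x.1 n = a} ≠ ⊤) ∧
    (∀ n : ℕ, 1 ≤ n → Compatible A ν (shiftSigma A n)) := by
  have hcoord : ∀ n a : ℕ, ν {x : Space A | x.1 n = a} ≠ ⊤ := by
    intro n a
    induction n with
    | zero =>
      have h : {x : Space A | x.1 0 = a} = cyl A [a] := by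
        ext x
        simp [cyl]
      rw [h]
      exact hfin a
    | succ n ih =>
      exact hconf.measure_preimage_shift_ne_top hφ hl hbdd (measurableSet_coord_eq n a) ih
  refine ⟨fun n _ a => hcoord n a, fun n _ => ⟨fun k => {x | x.1 n = k}, fun k => ?_,
    fun k => hcoord n k, ?_⟩⟩
  · refine ⟨{x | x.1 0 = k}, measurableSet_coord_eq 0 k, ?_⟩
    ext x
    simp [iterate_shift_apply]
  · ext x
    simp

end CMS
end

section
/- Let (Ω, 𝓑, μ) be a measure space and {𝓕_i}_{i≥1} a family of sub-σ-algebras of 𝓑 with 𝓕_i ⊆ 𝓕_{i+1} for every i ≥ 1, such that the restriction of μ to each 𝓕_i is σ-finite. Let 𝓕 := σ(⋃_{n≥1} 𝓕_n) and assume the restriction of μ to 𝓕 is σ-finite. Then for every f ∈ L¹(Ω, 𝓑, μ), the conditional expectations E_μ[f | 𝓕_n] converge to E_μ[f | 𝓕] as n → ∞, both μ-almost everywhere and in L¹(μ). -/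
open MeasureTheory Filter Topology ENNReal

namespace CMS

section Levy

variable {Ω : Type*} {m0 : MeasurableSpace Ω} {μ : Measure Ω}

/-- The conditional expectation is an `L¹`-contraction on every set of the sub-σ-algebra. -/
theorem eLpNorm_one_condExp_restrict_le {m : MeasurableSpace Ω} (hm : m ≤ m0)
    [SigmaFinite (μ.trim hm)] {s : Set Ω} (hs : MeasurableSet[m] s) {f : Ω → ℝ}
    (hf : Integrable f μ) :
    eLpNorm (μ[f|m]) 1 (μ.restrict s) ≤ eLpNorm f 1 (μ.restrict s) := by
  rw [← eLpNorm_congr_ae (condExp_restrict_ae_eq_restrict hm hs hf)]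
  exact eLpNorm_condExp_le_eLpNorm f le_rfl

theorem eLpNorm_one_restrict_add_compl (g : Ω → ℝ) {s : Set Ω} (hs : MeasurableSet s) :
    eLpNorm g 1 (μ.restrict s) + eLpNorm g 1 (μ.restrict sᶜ) = eLpNorm g 1 μ := by
  simp only [eLpNorm_one_eq_lintegral_enorm]
  exact lintegral_add_compl _ hs

/-- The `L¹` mass of an integrable function outside an exhausting sequence of sets vanishes. -/
theorem tendsto_eLpNorm_one_restrict_compl {f : Ω → ℝ} (hf : Integrable f μ) {s : ℕ → Set Ω}
    (hs : ∀ k, MeasurableSet (s k)) (hmono : Monotone s) (huniv : ⋃ k, s k = Set.univ) :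
    Tendsto (fun k => eLpNorm f 1 (μ.restrict (s k)ᶜ)) atTop (𝓝 0) := by
  have hfin : IsFiniteMeasure (μ.withDensity fun x => ‖f x‖ₑ) :=
    isFiniteMeasure_withDensity hf.2.ne
  have h := tendsto_measure_iInter_atTop (μ := μ.withDensity fun x => ‖f x‖ₑ)
    (s := fun k => (s k)ᶜ) (fun k => (hs k).compl.nullMeasurableSet)
    (fun i j hij => Set.compl_subset_compl.2 (hmono hij)) ⟨0, measure_ne_top _ _⟩
  rw [← Set.compl_iUnion, huniv, Set.compl_univ, measure_empty] at h
  refine h.congr fun k => ?_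
  rw [Function.comp_apply, withDensity_apply _ (hs k).compl, eLpNorm_one_eq_lintegral_enorm]

variable (ℱ : Filtration ℕ m0)

variable [∀ n, SigmaFinite (μ.trim (ℱ.le n))]
  [SigmaFinite (μ.trim (iSup_le ℱ.le : (⨆ n, ℱ n) ≤ m0))]

/-- Lévy's upward theorem, almost everywhere version, on a set of finite measure belonging to the
first σ-algebra of the filtration. -/
theorem tendsto_ae_condExp_restrict {f : Ω → ℝ} (hf : Integrable f μ) {s : Set Ω}
    (hs : MeasurableSet[ℱ 0] s) (hμs : μ s ≠ ∞) :
    ∀ᵐ x ∂μ.restrict s,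
      Tendsto (fun n => (μ[f|ℱ n]) x) atTop (𝓝 ((μ[f|⨆ n, ℱ n]) x)) := by
  have : IsFiniteMeasure (μ.restrict s) := isFiniteMeasure_restrict.2 hμs
  have hn : ∀ᵐ x ∂μ.restrict s, ∀ n, ((μ.restrict s)[f|ℱ n]) x = (μ[f|ℱ n]) x :=
    ae_all_iff.2 fun n => condExp_restrict_ae_eq_restrict (ℱ.le n) (ℱ.mono n.zero_le s hs) hf
  filter_upwards [hn, condExp_restrict_ae_eq_restrict (iSup_le ℱ.le) (le_iSup ℱ 0 s hs) hf,
    tendsto_ae_condExp (μ := μ.restrict s) (ℱ := ℱ) f] with x hx hx' ht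
  rw [← hx']
  exact ht.congr hx

/-- Lévy's upward theorem, `L¹` version, on a set of finite measure belonging to the first
σ-algebra of the filtration. -/
theorem tendsto_eLpNorm_condExp_restrict {f : Ω → ℝ} (hf : Integrable f μ) {s : Set Ω}
    (hs : MeasurableSet[ℱ 0] s) (hμs : μ s ≠ ∞) :
    Tendsto (fun n => eLpNorm (μ[f|ℱ n] - μ[f|⨆ n, ℱ n]) 1 (μ.restrict s)) atTop (𝓝 0) := by
  have : IsFiniteMeasure (μ.restrict s) := isFiniteMeasure_restrict.2 hμs
  refine (tendsto_eLpNorm_condExp (μ := μ.restrict s) (ℱ := ℱ) f).congr fun n =>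
    eLpNorm_congr_ae ?_
  exact (condExp_restrict_ae_eq_restrict (ℱ.le n) (ℱ.mono n.zero_le s hs) hf).sub
    (condExp_restrict_ae_eq_restrict (iSup_le ℱ.le) (le_iSup ℱ 0 s hs) hf)

/-- **Lévy's upward theorem** for σ-finite filtrations, almost everywhere version. -/
theorem tendsto_ae_condExp_of_sigmaFinite {f : Ω → ℝ} (hf : Integrable f μ) :
    ∀ᵐ x ∂μ, Tendsto (fun n => (μ[f|ℱ n]) x) atTop (𝓝 ((μ[f|⨆ n, ℱ n]) x)) := by
  let s := @spanningSets Ω (ℱ 0) (μ.trim (ℱ.le 0)) _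
  have hs : ∀ k, MeasurableSet[ℱ 0] (s k) := @measurableSet_spanningSets Ω (ℱ 0) _ _
  have hμs : ∀ k, μ (s k) ≠ ∞ := fun k =>
    ((le_trim (ℱ.le 0)).trans_lt (@measure_spanningSets_lt_top Ω (ℱ 0) _ _ k)).ne
  have huniv : ⋃ k, s k = Set.univ := @iUnion_spanningSets Ω (ℱ 0) _ _
  rw [← Measure.restrict_univ (μ := μ), ← huniv, ae_restrict_iUnion_iff, huniv,
    Measure.restrict_univ]
  exact fun k => tendsto_ae_condExp_restrict ℱ hf (hs k) (hμs k)

/-- **Lévy's upward theorem** for σ-finite filtrations, `L¹` version. -/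
theorem tendsto_eLpNorm_condExp_of_sigmaFinite {f : Ω → ℝ} (hf : Integrable f μ) :
    Tendsto (fun n => eLpNorm (μ[f|ℱ n] - μ[f|⨆ n, ℱ n]) 1 μ) atTop (𝓝 0) := by
  let s := @spanningSets Ω (ℱ 0) (μ.trim (ℱ.le 0)) _
  have hs : ∀ k, MeasurableSet[ℱ 0] (s k) := @measurableSet_spanningSets Ω (ℱ 0) _ _
  have hμs : ∀ k, μ (s k) ≠ ∞ := fun k =>
    ((le_trim (ℱ.le 0)).trans_lt (@measure_spanningSets_lt_top Ω (ℱ 0) _ _ k)).ne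
  have huniv : ⋃ k, s k = Set.univ := @iUnion_spanningSets Ω (ℱ 0) _ _
  have htail := tendsto_eLpNorm_one_restrict_compl hf (fun k => ℱ.le 0 _ (hs k))
    (@monotone_spanningSets Ω (ℱ 0) _ _) huniv
  rw [ENNReal.tendsto_nhds_zero]
  intro ε hε
  have hε3 : 0 < ε / 3 := ENNReal.div_pos hε.ne' (by simp)
  obtain ⟨k, hk⟩ := (ENNReal.tendsto_nhds_zero.1 htail (ε / 3) hε3).exists
  filter_upwards [ENNReal.tendsto_nhds_zero.1
    (tendsto_eLpNorm_condExp_restrict ℱ hf (hs k) (hμs k)) (ε / 3) hε3] with n hn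
  have hcompl : eLpNorm (μ[f|ℱ n] - μ[f|⨆ n, ℱ n]) 1 (μ.restrict (s k)ᶜ) ≤ ε / 3 + ε / 3 :=
    calc
      _ ≤ eLpNorm (μ[f|ℱ n]) 1 (μ.restrict (s k)ᶜ)
          + eLpNorm (μ[f|⨆ n, ℱ n]) 1 (μ.restrict (s k)ᶜ) :=
        eLpNorm_sub_le integrable_condExp.aestronglyMeasurable.restrict
          integrable_condExp.aestronglyMeasurable.restrict le_rfl
      _ ≤ ε / 3 + ε / 3 := add_le_add
        ((eLpNorm_one_condExp_restrict_le (ℱ.le n)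
          (ℱ.mono n.zero_le _ (hs k).compl) hf).trans hk)
        ((eLpNorm_one_condExp_restrict_le (iSup_le ℱ.le)
          (le_iSup ℱ 0 _ (hs k).compl) hf).trans hk)
  calc
    _ = _ := (eLpNorm_one_restrict_add_compl _ (ℱ.le 0 _ (hs k))).symm
    _ ≤ ε / 3 + (ε / 3 + ε / 3) := add_le_add hn hcompl
    _ = ε := by rw [← add_assoc, ENNReal.add_thirds]

end Levy

theorem statement3 {Ω : Type} {m0 : MeasurableSpace Ω} (μ : Measure Ω)
    (F : ℕ → MeasurableSpace Ω) (hle : ∀ i, F i ≤ m0)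
    (hmono : ∀ i, F i ≤ F (i + 1))
    (hsf : ∀ i, SigmaFinite (μ.trim (hle i)))
    (hsup : SigmaFinite (μ.trim (iSup_le hle : (⨆ i, F i) ≤ m0)))
    (f : Ω → ℝ) (hf : Integrable f μ) :
    (∀ᵐ x ∂μ, Tendsto (fun n => (μ[f|F n]) x) atTop (nhds ((μ[f|⨆ i, F i]) x))) ∧
    Tendsto (fun n => eLpNorm ((μ[f|F n]) - μ[f|⨆ i, F i]) 1 μ) atTop (nhds 0) := by
  let ℱ : Filtration ℕ m0 := ⟨F, monotone_nat_of_le_succ hmono, hle⟩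
  have : ∀ n, SigmaFinite (μ.trim (ℱ.le n)) := hsf
  have : SigmaFinite (μ.trim (iSup_le ℱ.le : (⨆ n, ℱ n) ≤ m0)) := hsup
  exact ⟨tendsto_ae_condExp_of_sigmaFinite ℱ hf, tendsto_eLpNorm_condExp_of_sigmaFinite ℱ hf⟩

end CMS
end
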